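/- Let U be a finite set of features and let 𝓕 be a family of subsets of U with ∅ ∉ 𝓕. Define the model M : (U → Bool) → Bool by M(e) = true if and only if there exists F' ∈ 𝓕 with F' ⊆ {u ∈ U : e(u) = true}, and let e₀ be the all-zero example. Then for every set S ⊆ U the following are equivalent: (1) S is a local abductive explanation for e₀ w.r.t. M; (2) there exists a partial example τ : S → Bool that is a global abductive explanation for the class false w.r.t. M; (3) there exists a partial example τ : S → Bool that is a global contrastive explanation for the class true w.r.t. M. -/

import Mathlib

/-- `A` is a local abductive explanation (lAXp) for example `e` w.r.t. model `M`. -/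
def IsLAXp {U : Type*} (M : (U → Bool) → Bool) (e : U → Bool) (A : Set U) : Prop :=
  ∀ e' : U → Bool, (∀ u ∈ A, e' u = e u) → M e' = M e

/-- The partial example with domain `dom` and values `τ` is a global abductive
explanation (gAXp) for class `c` w.r.t. model `M`. -/
def IsGAXp {U : Type*} (M : (U → Bool) → Bool) (dom : Set U) (τ : U → Bool) (c : Bool) : Prop :=
  ∀ e : U → Bool, (∀ u ∈ dom, e u = τ u) → M e = c

/-- The partial example with domain `dom` and values `τ` is a global contrastive
explanation (gCXp) for class `c` w.r.t. model `M`. -/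
def IsGCXp {U : Type*} (M : (U → Bool) → Bool) (dom : Set U) (τ : U → Bool) (c : Bool) : Prop :=
  ∀ e : U → Bool, (∀ u ∈ dom, e u = τ u) → M e ≠ c

/-- The model classifying `e` positively iff some member of `𝓕` is contained in the
set of features set to `true` by `e`. -/
def subsetModel {U : Type*} [Fintype U] [DecidableEq U] (𝓕 : Finset (Finset U)) :
    (U → Bool) → Bool :=
  fun e => decide (∃ F' ∈ 𝓕, F' ⊆ Finset.univ.filter fun u => e u = true)

theorem subsetModel_mono {U : Type*} [Fintype U] [DecidableEq U] (𝓕 : Finset (Finset U)) :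
    Monotone (subsetModel 𝓕) := by
  intro e e' h he
  simp only [subsetModel, decide_eq_true_eq] at he ⊢
  obtain ⟨F, hF, hFe⟩ := he
  refine ⟨F, hF, fun u hu => ?_⟩
  have hu' := hFe hu
  simp only [Finset.mem_filter, Finset.mem_univ, true_and] at hu' ⊢
  exact h u hu'

theorem subsetModel_zero {U : Type*} [Fintype U] [DecidableEq U] {𝓕 : Finset (Finset U)}
    (hF : ∅ ∉ 𝓕) : subsetModel 𝓕 (fun _ => false) = false := by
  simpa [subsetModel] using hF

theorem isLAXp_zero_of_isGAXp {U : Type*} {M : (U → Bool) → Bool} (hM : Monotone M)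
    (h0 : M (fun _ => false) = false) {A : Set U} {τ : U → Bool} (h : IsGAXp M A τ false) :
    IsLAXp M (fun _ => false) A := by
  classical
  intro e he
  have hle : e ≤ A.piecewise τ e := by
    intro u
    by_cases hu : u ∈ A
    · simp [he u hu]
    · simp [hu]
  have hfalse : M (A.piecewise τ e) = false := h _ fun u hu => by simp [hu]
  rw [h0]
  exact le_bot_iff.mp ((hM hle).trans hfalse.le)

theorem isGCXp_true_iff_isGAXp_false {U : Type*} {M : (U → Bool) → Bool} {A : Set U}
    {τ : U → Bool} : IsGCXp M A τ true ↔ IsGAXp M A τ false := by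
  simp [IsGCXp, IsGAXp]

theorem stmt6 (U : Type*) [Fintype U] [DecidableEq U]
    (𝓕 : Finset (Finset U)) (hF : ∅ ∉ 𝓕) (S : Finset U) :
    List.TFAE
      [ IsLAXp (subsetModel 𝓕) (fun _ => false) (↑S : Set U),
        ∃ τ : U → Bool, IsGAXp (subsetModel 𝓕) (↑S : Set U) τ false,
        ∃ τ : U → Bool, IsGCXp (subsetModel 𝓕) (↑S : Set U) τ true ] := by
  have h0 := subsetModel_zero hF
  tfae_have 1 → 2 := fun h => ⟨fun _ => false, fun e he => (h e he).trans h0⟩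
  tfae_have 2 → 1 := fun ⟨_, h⟩ => isLAXp_zero_of_isGAXp (subsetModel_mono 𝓕) h0 h
  tfae_have 2 ↔ 3 := exists_congr fun _ => isGCXp_true_iff_isGAXp_false.symm
  tfae_finish
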